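/- Let X be a topological space with a Kuratowski partition F = {F_α : α < κ}, and let f, g ∈ FN(κ). Then the set {x ∈ X : f(x) < g(x)} has the Baire property in X. -/

import Mathlib

open Set

/-- A set has the Baire property iff it is the symmetric difference of an open set
and a meager set. -/
def HasBaireProperty {X : Type*} [TopologicalSpace X] (E : Set X) : Prop :=
  ∃ V M : Set X, IsOpen V ∧ IsMeagre M ∧ E = symmDiff V M

/-- An indexed (enumerated) Kuratowski partition `F = {F_α : α < κ}`: a partition of `X`
into (nonempty) meager sets such that the union of every subfamily has the Baire
property. -/
def IsKuratowskiFamily {X : Type*} {ι : Type*} [TopologicalSpace X] (F : ι → Set X) : Prop :=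
  (∀ i, IsMeagre (F i)) ∧ (∀ i, (F i).Nonempty) ∧ Pairwise (Function.onFun Disjoint F) ∧
    (⋃ i, F i) = Set.univ ∧ ∀ s : Set ι, HasBaireProperty (⋃ i ∈ s, F i)

/-- `f ∈ FN(κ)`: there is a family `𝒰_f` of pairwise disjoint open sets whose union is
dense in `X` such that `f` is constant on `F_α ∩ U` for every `α < κ` and every
`U ∈ 𝒰_f`. -/
def MemFN {X : Type*} {ι : Type*} [TopologicalSpace X] (F : ι → Set X) (f : X → ι) : Prop :=
  ∃ 𝒰 : Set (Set X), (∀ U ∈ 𝒰, IsOpen U) ∧ 𝒰.PairwiseDisjoint id ∧ Dense (⋃₀ 𝒰) ∧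
    ∀ i : ι, ∀ U ∈ 𝒰, ∀ x ∈ F i ∩ U, ∀ y ∈ F i ∩ U, f x = f y

/-- A union of nowhere dense sets lying in pairwise disjoint open sets is nowhere dense. -/
theorem isNowhereDense_iUnion_inter_of_pairwise_disjoint {X J : Type*} [TopologicalSpace X]
    {W N : J → Set X} (hW : ∀ j, IsOpen (W j)) (hd : Pairwise (Function.onFun Disjoint W))
    (hN : ∀ j, IsNowhereDense (N j)) : IsNowhereDense (⋃ j, N j ∩ W j) := by
  rw [IsNowhereDense, eq_empty_iff_forall_notMem]
  intro x hx
  obtain ⟨y, hyO, hyN⟩ := mem_closure_iff.1 (interior_subset hx) _ isOpen_interior hx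
  obtain ⟨j, -, hyW⟩ := mem_iUnion.1 hyN
  have hsub : interior (closure (⋃ j, N j ∩ W j)) ∩ W j ⊆ interior (closure (N j)) := by
    refine interior_maximal ?_ (isOpen_interior.inter (hW j))
    rintro z ⟨hzO, hzW⟩
    refine closure_mono ?_ ((hW j).inter_closure ⟨hzW, interior_subset hzO⟩)
    rintro w ⟨hwW, hw⟩
    obtain ⟨k, hwN, hwk⟩ := mem_iUnion.1 hw
    obtain rfl : j = k := hd.eq (not_disjoint_iff.2 ⟨w, hwW, hwk⟩)
    exact hwN
  have hy := hsub ⟨hyO, hyW⟩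
  rw [hN j] at hy
  exact hy

/-- A meager set is covered by a sequence of nowhere dense sets. -/
theorem IsMeagre.exists_seq_isNowhereDense {X : Type*} [TopologicalSpace X] {M : Set X}
    (hM : IsMeagre M) : ∃ N : ℕ → Set X, (∀ n, IsNowhereDense (N n)) ∧ M ⊆ ⋃ n, N n := by
  obtain ⟨S, hS, hSc, hMS⟩ := isMeagre_iff_countable_union_isNowhereDense.1 hM
  obtain ⟨N, hN⟩ := (hSc.insert ∅).exists_eq_range (insert_nonempty _ _)
  refine ⟨N, fun n => ?_, ?_⟩
  · rcases (hN ▸ mem_range_self n : N n ∈ insert ∅ S) with h | h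
    · rw [h]
      exact isNowhereDense_empty
    · exact hS _ h
  · rw [← sUnion_range, ← hN]
    exact hMS.trans (sUnion_subset_sUnion (subset_insert _ _))

/-- A union of meager sets lying in pairwise disjoint open sets is meager. -/
theorem isMeagre_iUnion_inter_of_pairwise_disjoint {X J : Type*} [TopologicalSpace X]
    {W M : J → Set X} (hW : ∀ j, IsOpen (W j)) (hd : Pairwise (Function.onFun Disjoint W))
    (hM : ∀ j, IsMeagre (M j)) : IsMeagre (⋃ j, M j ∩ W j) := by
  choose N hN hMN using fun j => (hM j).exists_seq_isNowhereDense
  refine (isMeagre_iUnion fun n => (isNowhereDense_iUnion_inter_of_pairwise_disjoint hW hd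
    fun j => hN j n).isMeagre).mono ?_
  intro x hx
  obtain ⟨j, hxM, hxW⟩ := mem_iUnion.1 hx
  obtain ⟨n, hn⟩ := mem_iUnion.1 (hMN j hxM)
  exact mem_iUnion.2 ⟨n, mem_iUnion.2 ⟨j, hn, hxW⟩⟩

/-- A set that agrees with sets having the Baire property on the members of a family of pairwise
disjoint open sets with dense union has the Baire property. -/
theorem HasBaireProperty.of_pairwise_disjoint_of_dense {X J : Type*} [TopologicalSpace X]
    {W B : J → Set X} {E : Set X} (hW : ∀ j, IsOpen (W j))
    (hd : Pairwise (Function.onFun Disjoint W)) (hD : Dense (⋃ j, W j))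
    (hB : ∀ j, HasBaireProperty (B j)) (hE : ∀ j, ∀ x ∈ W j, x ∈ E ↔ x ∈ B j) :
    HasBaireProperty E := by
  choose A M hA hM hAM using hB
  refine ⟨⋃ j, A j ∩ W j, symmDiff (⋃ j, A j ∩ W j) E,
    isOpen_iUnion fun j => (hA j).inter (hW j), ?_, (symmDiff_symmDiff_cancel_left _ _).symm⟩
  have hDc : IsMeagre (⋃ j, W j)ᶜ := by
    rw [IsMeagre, compl_compl]
    exact residual_of_dense_open (isOpen_iUnion hW) hD
  refine ((isMeagre_iUnion_inter_of_pairwise_disjoint hW hd hM).union hDc).mono ?_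
  intro x hx
  by_cases hxD : x ∈ ⋃ j, W j
  · obtain ⟨j, hxW⟩ := mem_iUnion.1 hxD
    refine Or.inl (mem_iUnion.2 ⟨j, ?_, hxW⟩)
    have hxV : x ∈ (⋃ j, A j ∩ W j) ↔ x ∈ A j := by
      refine ⟨fun h => ?_, fun h => mem_iUnion.2 ⟨j, h, hxW⟩⟩
      obtain ⟨k, hxA, hxk⟩ := mem_iUnion.1 h
      obtain rfl : j = k := hd.eq (not_disjoint_iff.2 ⟨x, hxW, hxk⟩)
      exact hxA
    have hxE := hE j x hxW
    rw [hAM j, mem_symmDiff] at hxE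
    rw [mem_symmDiff, hxV] at hx
    tauto
  · exact Or.inr hxD

/-- If `F = {F_α : α < κ}` is a Kuratowski partition of `X` and
`f, g ∈ FN(κ)`, then `{x : f(x) < g(x)}` has the Baire property. -/
theorem baireProperty_lt_of_memFN {X : Type*} {ι : Type*} [TopologicalSpace X]
    [LinearOrder ι] (F : ι → Set X) (hF : IsKuratowskiFamily F)
    (f g : X → ι) (hf : MemFN F f) (hg : MemFN F g) :
    HasBaireProperty {x : X | f x < g x} := by
  obtain ⟨-, -, -, hcover, hBP⟩ := hF
  obtain ⟨𝒰, hUo, hUd, hUD, hUc⟩ := hf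
  obtain ⟨𝒱, hVo, hVd, hVD, hVc⟩ := hg
  let W : 𝒰 × 𝒱 → Set X := fun j => j.1 ∩ j.2
  refine HasBaireProperty.of_pairwise_disjoint_of_dense (W := W)
    (B := fun j => ⋃ i ∈ {i | ∃ y ∈ F i ∩ W j, f y < g y}, F i)
    (fun j => (hUo _ j.1.2).inter (hVo _ j.2.2)) ?_ ?_ (fun j => hBP _) ?_
  · rintro ⟨U, V⟩ ⟨U', V'⟩ hne
    refine disjoint_left.2 fun x hx hx' => hne (Prod.ext (Subtype.ext ?_) (Subtype.ext ?_))
    · exact hUd.elim U.2 U'.2 (not_disjoint_iff.2 ⟨x, hx.1, hx'.1⟩)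
    · exact hVd.elim V.2 V'.2 (not_disjoint_iff.2 ⟨x, hx.2, hx'.2⟩)
  · refine (hUD.inter_of_isOpen_left hVD (isOpen_sUnion hUo)).mono ?_
    rintro x ⟨⟨U, hU, hxU⟩, V, hV, hxV⟩
    exact mem_iUnion.2 ⟨(⟨U, hU⟩, ⟨V, hV⟩), hxU, hxV⟩
  · intro j x hx
    constructor
    · intro hlt
      obtain ⟨i, hi⟩ := mem_iUnion.1 (hcover ▸ mem_univ x : x ∈ ⋃ i, F i)
      exact mem_biUnion (show i ∈ {i | ∃ y ∈ F i ∩ W j, f y < g y} from ⟨x, ⟨hi, hx⟩, hlt⟩) hi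
    · intro h
      obtain ⟨i, ⟨y, ⟨hyF, hyW⟩, hlt⟩, hxF⟩ := mem_iUnion₂.1 h
      rw [mem_ofPred_eq, hUc i _ j.1.2 x ⟨hxF, hx.1⟩ y ⟨hyF, hyW.1⟩,
        hVc i _ j.2.2 x ⟨hxF, hx.2⟩ y ⟨hyF, hyW.2⟩]
      exact hlt
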